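/- Let D, M > 0, let λ be a probability measure on [D,2D] with λ([D*,2D]) > c for some D* ∈ (D,2D) and c > 0, let β ∈ (D, D*), and let θ0 be the counterexample signal (with K chosen sufficiently small). For each j let D' = D'(n_j) ∈ [D, 2D − 1/log n_j] satisfy λ([D' + 1/(2 log n_j), D' + 1/log n_j]) > c/(2 log n_j). Then there exist constants C, c1 > 0 such that for all sufficiently large j, E_{θ0} λ( [D, D'] | X ) ≤ C exp(−c1 n_j^{1/(1+4D)}) log n_j. -/

import Mathlib

open MeasureTheory ProbabilityTheory Real Filter
open scoped NNReal ENNReal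

noncomputable section

/-- The real index corresponding to coordinate `i : ℕ` is `i + 1`
(sequences are indexed by `1, 2, 3, ...` in the paper). -/
def idx (i : ℕ) : ℝ := (i : ℝ) + 1

/-- ℓ²-norm of a sequence. -/
def l2norm (x : ℕ → ℝ) : ℝ := Real.sqrt (∑' i, (x i) ^ 2)

/-- The Sobolev ball `S^β(M) = {θ ∈ ℓ² : ∑ i^{2β} θ_i² ≤ M}`. -/
def sobolev (β M : ℝ) : Set (ℕ → ℝ) :=
  {θ | Summable (fun i => (θ i) ^ 2) ∧ ∑' i, (idx i) ^ (2 * β) * (θ i) ^ 2 ≤ M}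

/-- Truncation level `k_n = n^{2/(1+4D)}`. -/
def khat (D : ℝ) (n : ℕ) : ℕ := ⌊(n : ℝ) ^ (2 / (1 + 4 * D))⌋₊

/-- Truncated squared bias `B_{n,k}²(α;θ0) = ∑_{i=1}^k i^{2+4α} θ0_i²/(i^{1+2α}+n)²`. -/
def biasSqTrunc (n k : ℕ) (α : ℝ) (θ0 : ℕ → ℝ) : ℝ :=
  ∑ i ∈ Finset.range k, (idx i) ^ (2 + 4 * α) * (θ0 i) ^ 2 / ((idx i) ^ (1 + 2 * α) + n) ^ 2

/-- The constant `C0 = ((1+4D)² log(25 C1⁻² γ⁻¹)/2) ∨ 0`. -/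
def C0def (D C1 γ : ℝ) : ℝ := max ((1 + 4 * D) ^ 2 * Real.log (25 * (C1 ^ 2)⁻¹ * γ⁻¹) / 2) 0

/-- The cap `(2D − C0/log n) ∨ D`. -/
def capVal (D C1 γ : ℝ) (n : ℕ) : ℝ := max (2 * D - C0def D C1 γ / Real.log n) D

open Classical in
/-- `(inf S) ∧ c` with the convention that the infimum of the empty set is `+∞`. -/
def infAux (S : Set ℝ) (c : ℝ) : ℝ := if S.Nonempty then min (sInf S) c else c

/-- `α̲_n`. -/
def underAlpha (D C1 γ : ℝ) (n : ℕ) (θ0 : ℕ → ℝ) : ℝ :=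
  infAux {α | D ≤ α ∧ C1 ^ 2 / 2 * (n : ℝ) ^ (-(2 * α) / (1 + 2 * α)) ≤ biasSqTrunc n (khat D n) α θ0}
    (capVal D C1 γ n)

/-- `ᾱ_n`. -/
def overAlpha (D C1 γ : ℝ) (n : ℕ) (θ0 : ℕ → ℝ) : ℝ :=
  infAux {α | D ≤ α ∧ 2 * C1 ^ 2 * (n : ℝ) ^ (-(2 * α) / (1 + 2 * α)) ≤ biasSqTrunc n (khat D n) α θ0}
    (capVal D C1 γ n)

/-- Finite-dimensional distributions of the observation in the signal-in-white-noise model: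
the product over `j ∈ J` of `N(θ0_j, 1/n)`. -/
def obsFDD (n : ℕ) (θ0 : ℕ → ℝ) (J : Finset ℕ) : Measure (∀ _ : J, ℝ) :=
  Measure.pi (fun j : J => gaussianReal (θ0 j) ((n : ℝ≥0))⁻¹)

/-- `P` is the law `P_{θ0}` of the observation, i.e. the countable product `⊗_i N(θ0_i, 1/n)`,
characterized as the projective limit of its finite-dimensional distributions. -/
def IsObsLaw (n : ℕ) (θ0 : ℕ → ℝ) (P : Measure (ℕ → ℝ)) : Prop :=
  IsProjectiveLimit P (obsFDD n θ0)

/-- Finite-dimensional distributions of the centered posterior noise: the product over `j ∈ J`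
of `N(0, 1/(j^{1+2α}+n))`. -/
def noiseFDD (n : ℕ) (α : ℝ) (J : Finset ℕ) : Measure (∀ _ : J, ℝ) :=
  Measure.pi (fun j : J => gaussianReal 0 (Real.toNNReal ((idx j) ^ (1 + 2 * α) + n))⁻¹)

/-- `N` is the centered posterior noise law `⊗_i N(0, 1/(i^{1+2α}+n))`. -/
def IsNoiseLaw (n : ℕ) (α : ℝ) (N : Measure (ℕ → ℝ)) : Prop :=
  IsProjectiveLimit N (noiseFDD n α)

/-- Posterior mean: `θ̂_{n,α,i} = n X_i/(i^{1+2α}+n)`. -/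
def postMean (n : ℕ) (α : ℝ) (X : ℕ → ℝ) (i : ℕ) : ℝ :=
  (n : ℝ) * X i / ((idx i) ^ (1 + 2 * α) + n)

/-- The radius `r_{n,γ}(α)`: the `(1−γ)`-quantile of the ℓ²-norm under the centered
posterior noise law `Nm n α`. -/
def radius (Nm : ℕ → ℝ → Measure (ℕ → ℝ)) (n : ℕ) (γ α : ℝ) : ℝ :=
  sInf {r : ℝ | ENNReal.ofReal (1 - γ) ≤ Nm n α {x | l2norm x ≤ r}}

/-- The marginal log-likelihood `ℓ_n(α)`. -/
def logLik (n : ℕ) (α : ℝ) (X : ℕ → ℝ) : ℝ :=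
  -(1 / 2) * ∑' i : ℕ, (Real.log (1 + (n : ℝ) / (idx i) ^ (1 + 2 * α))
    - (n : ℝ) ^ 2 * (X i) ^ 2 / ((idx i) ^ (1 + 2 * α) + n))

/-- The bias estimator `B̂_{n,k}²(α)`. -/
def biasEstSq (n k : ℕ) (α : ℝ) (X : ℕ → ℝ) : ℝ :=
  ∑ i ∈ Finset.range k, (idx i) ^ (2 + 4 * α) / ((idx i) ^ (1 + 2 * α) + n) ^ 2
    * ((X i) ^ 2 - 1 / n)

/-- The risk-based empirical Bayes estimator `α̃_n`. -/
def tildeAlpha (D C1 γ : ℝ) (n : ℕ) (X : ℕ → ℝ) : ℝ :=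
  infAux {α | D ≤ α ∧ C1 * (n : ℝ) ^ (-α / (1 + 2 * α)) ≤ Real.sqrt (biasEstSq n (khat D n) α X)}
    (capVal D C1 γ n)

/-- The block-boundary `N_j = n_j^{1/(1+2β)}` associated with `n_j`. -/
def blockEdge (β : ℝ) (m : ℕ) : ℝ := (m : ℝ) ^ (1 / (1 + 2 * β))

/-- The counterexample signal: `θ0_i² = K i^{−1−2β}` if `n_j^{1/(1+2β)} ≤ i < 2 n_j^{1/(1+2β)}`
for some `j`, and `θ0_i = 0` otherwise (coordinate `i : ℕ` has actual index `i+1`). -/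
def counterSignal (β K : ℝ) (nseq : ℕ → ℕ) : ℕ → ℝ :=
  Set.indicator {i : ℕ | ∃ j, blockEdge β (nseq j) ≤ idx i ∧ idx i < 2 * blockEdge β (nseq j)}
    (fun i => Real.sqrt (K * (idx i) ^ (-(1 + 2 * β))))

/-- The growth conditions on the sequence `n_j`: `n_1 ≥ 2`, strictly increasing,
and `n_{j+1}/n_j^{1+4D} → ∞`. -/
def goodSeq (D : ℝ) (nseq : ℕ → ℕ) : Prop :=
  2 ≤ nseq 0 ∧ StrictMono nseq ∧
    Filter.Tendsto (fun j => (nseq (j + 1) : ℝ) / (nseq j : ℝ) ^ (1 + 4 * D))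
      Filter.atTop Filter.atTop

/-- The hyper-posterior mass of a set `A ⊆ [D,2D]`:
`λ(A|X) = ∫_A e^{ℓ_n(α)} λ(dα) / ∫_{[D,2D]} e^{ℓ_n(α)} λ(dα)`. -/
def hyperProbOn (lam : Measure ℝ) (D : ℝ) (n : ℕ) (X : ℕ → ℝ) (A : Set ℝ) : ℝ :=
  (∫ α in A, Real.exp (logLik n α X) ∂lam) /
    ∫ α in Set.Icc D (2 * D), Real.exp (logLik n α X) ∂lam


section helpers1

lemma gauss_mgf (θ s : ℝ) (n : ℕ) (hn : 0 < n) (hs : s < 1) :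
    ∫⁻ x, ENNReal.ofReal (Real.exp (s * (n * x ^ 2) / 2)) ∂(gaussianReal θ ((n : ℝ≥0))⁻¹)
      = ENNReal.ofReal ((Real.sqrt (1 - s))⁻¹ * Real.exp (s * (n * θ ^ 2) / (2 * (1 - s)))) := by
  have hn' : (0 : ℝ) < n := by exact_mod_cast hn
  have hs' : 0 < 1 - s := by linarith
  have hv : ((n : ℝ≥0))⁻¹ ≠ 0 := by positivity
  set w : ℝ≥0 := Real.toNNReal ((n * (1 - s))⁻¹) with hw
  have hwv : (w : ℝ) = (n * (1 - s))⁻¹ := by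
    rw [hw, Real.coe_toNNReal]; positivity
  have hw0 : w ≠ 0 := by
    have : (w : ℝ) ≠ 0 := by rw [hwv]; positivity
    exact_mod_cast this
  rw [gaussianReal_of_var_ne_zero _ hv,
    lintegral_withDensity_eq_lintegral_mul _ (measurable_gaussianPDF _ _) (by fun_prop)]
  have key : ∀ x, (gaussianPDF θ ((n : ℝ≥0))⁻¹ * fun x => ENNReal.ofReal (Real.exp (s * (n * x ^ 2) / 2))) x
      = ENNReal.ofReal ((Real.sqrt (1 - s))⁻¹ * Real.exp (s * (n * θ ^ 2) / (2 * (1 - s))))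
        * gaussianPDF (θ / (1 - s)) w x := by
    intro x
    simp only [Pi.mul_apply, gaussianPDF]
    rw [← ENNReal.ofReal_mul (gaussianPDFReal_nonneg _ _ _), ← ENNReal.ofReal_mul (by positivity)]
    congr 1
    simp only [gaussianPDFReal, hwv]
    push_cast
    have e1 : √(2 * π * (n : ℝ)⁻¹) = √(1 - s) * √(2 * π * (n * (1 - s))⁻¹) := by
      rw [← Real.sqrt_mul hs'.le]; congr 1; field_simp
    have e2 : Real.exp (-(x - θ) ^ 2 / (2 * (n : ℝ)⁻¹)) * Real.exp (s * (n * x ^ 2) / 2)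
        = Real.exp (s * (n * θ ^ 2) / (2 * (1 - s)))
          * Real.exp (-(x - θ / (1 - s)) ^ 2 / (2 * (n * (1 - s))⁻¹)) := by
      rw [← Real.exp_add, ← Real.exp_add]
      congr 1
      field_simp
      ring
    rw [e1, mul_inv, mul_assoc, e2]
    ring
  simp_rw [key]
  rw [lintegral_const_mul _ (measurable_gaussianPDF _ _), lintegral_gaussianPDF_eq_one _ hw0, mul_one]

lemma obs_eq (n : ℕ) (θ0 : ℕ → ℝ) (P : Measure (ℕ → ℝ)) (h : IsObsLaw n θ0 P) :
    P = Measure.infinitePi (fun i => gaussianReal (θ0 i) ((n : ℝ≥0))⁻¹) := by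
  have : ∀ J, IsFiniteMeasure (obsFDD n θ0 J) := fun J => by unfold obsFDD; infer_instance
  exact IsProjectiveLimit.unique h (Measure.isProjectiveLimit_infinitePi _)

lemma obs_prod (n : ℕ) (θ0 : ℕ → ℝ) (P : Measure (ℕ → ℝ)) (h : IsObsLaw n θ0 P)
    (f : ℕ → ℝ → ℝ≥0∞) (hf : ∀ i, Measurable (f i)) (J : ℕ) :
    ∫⁻ X, ∏ i ∈ Finset.range J, f i (X i) ∂P
      = ∏ i ∈ Finset.range J, ∫⁻ x, f i x ∂(gaussianReal (θ0 i) ((n : ℝ≥0))⁻¹) := by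
  rw [obs_eq n θ0 P h]
  have h2 := lintegral_prod_eq_prod_lintegral_of_indepFun (Finset.range J)
    (fun i (X : ℕ → ℝ) => f i (X i))
    (iIndepFun_infinitePi (P := fun i => gaussianReal (θ0 i) ((n : ℝ≥0))⁻¹) (X := f) hf)
    (fun i => (hf i).comp (measurable_pi_apply i))
  refine h2.trans ?_
  refine Finset.prod_congr rfl fun i _ => ?_
  exact (measurePreserving_eval_infinitePi _ i).lintegral_comp (hf i)

lemma obs_single (n : ℕ) (θ0 : ℕ → ℝ) (P : Measure (ℕ → ℝ)) (h : IsObsLaw n θ0 P)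
    (f : ℝ → ℝ≥0∞) (hf : Measurable f) (i : ℕ) :
    ∫⁻ X, f (X i) ∂P = ∫⁻ x, f x ∂(gaussianReal (θ0 i) ((n : ℝ≥0))⁻¹) := by
  rw [obs_eq n θ0 P h]
  exact (measurePreserving_eval_infinitePi _ i).lintegral_comp hf

lemma gauss_sq (θ : ℝ) (v : ℝ≥0) :
    ∫⁻ x, ENNReal.ofReal (x ^ 2) ∂(gaussianReal θ v) = ENNReal.ofReal (v + θ ^ 2) := by
  have hm : MemLp id 2 (gaussianReal θ v) := memLp_id_gaussianReal 2
  rw [← ofReal_integral_eq_lintegral_ofReal]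
  · congr 1
    have := variance_eq_sub hm
    rw [variance_id_gaussianReal] at this
    simp only [Pi.pow_apply, id, integral_id_gaussianReal] at this
    linarith
  · exact hm.integrable_sq
  · exact Filter.Eventually.of_forall fun x => sq_nonneg x

/-- almost sure summability of weighted squares -/
lemma ae_summable (n : ℕ) (θ0 : ℕ → ℝ) (P : Measure (ℕ → ℝ)) (h : IsObsLaw n θ0 P)
    (w : ℕ → ℝ) (hw : ∀ i, 0 ≤ w i) (hws : Summable w) (M : ℝ) (hM : ∀ i, θ0 i ^ 2 ≤ M) :
    ∀ᵐ X ∂P, Summable (fun i => w i * X i ^ 2) := by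
  have hme : ∀ i, Measurable (fun X : ℕ → ℝ => ENNReal.ofReal (w i * X i ^ 2)) := fun i => by
    fun_prop
  have h1 : ∫⁻ X, ∑' i, ENNReal.ofReal (w i * X i ^ 2) ∂P ≠ ⊤ := by
    rw [lintegral_tsum (fun i => (hme i).aemeasurable)]
    have h2 : ∀ i, ∫⁻ X, ENNReal.ofReal (w i * X i ^ 2) ∂P
        ≤ ENNReal.ofReal (w i * ((((n : ℝ≥0))⁻¹ : ℝ≥0) + M)) := by
      intro i
      rw [obs_single n θ0 P h (fun x => ENNReal.ofReal (w i * x ^ 2)) (by fun_prop) i]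
      simp_rw [ENNReal.ofReal_mul (hw i)]
      rw [lintegral_const_mul _ (by fun_prop), gauss_sq]
      gcongr
      exact hM i
    have h3 : Summable (fun i => w i * ((((n : ℝ≥0))⁻¹ : ℝ≥0) + M : ℝ)) := hws.mul_right _
    refine ne_top_of_le_ne_top ?_ (ENNReal.tsum_le_tsum h2)
    exact h3.tsum_ofReal_ne_top
  have h4 := ae_lt_top (Measurable.ennreal_tsum hme) h1
  filter_upwards [h4] with X hX
  have := ENNReal.summable_toReal hX.ne
  refine this.congr fun i => ?_
  rw [ENNReal.toReal_ofReal (mul_nonneg (hw i) (sq_nonneg _))]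

end helpers1

section helpers2

/-- shrinkage factor -/
def pp (n : ℕ) (α : ℝ) (i : ℕ) : ℝ := (n : ℝ) / ((idx i) ^ (1 + 2 * α) + n)

/-- one summand of the log-likelihood -/
def lterm (n : ℕ) (α : ℝ) (i : ℕ) (x : ℝ) : ℝ :=
  Real.log (1 + (n : ℝ) / (idx i) ^ (1 + 2 * α)) - (n : ℝ) ^ 2 * x ^ 2 / ((idx i) ^ (1 + 2 * α) + n)

/-- potential -/
def HJ (n : ℕ) (θ0 : ℕ → ℝ) (J : ℕ) (α : ℝ) : ℝ :=
  ∑ i ∈ Finset.range J, (pp n α i ^ 2 - 8 * pp n α i * (n * θ0 i ^ 2))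

lemma idx_ge (i : ℕ) : 1 ≤ idx i := by unfold idx; linarith [Nat.cast_nonneg (α := ℝ) i]
lemma idx_pos (i : ℕ) : 0 < idx i := lt_of_lt_of_le one_pos (idx_ge i)

lemma logLik_eq (n : ℕ) (α : ℝ) (X : ℕ → ℝ) :
    logLik n α X = -(1 / 2) * ∑' i, lterm n α i (X i) := rfl

lemma log_aux {p q : ℝ} (hq : 0 ≤ q) (hqp : q ≤ p) (hp : p < 1) :
    (p - q) + (p ^ 2 - q ^ 2) / 2 ≤ Real.log (1 - q) - Real.log (1 - p) := by
  have hmono : MonotoneOn (fun x : ℝ => -Real.log (1 - x) - x - x ^ 2 / 2) (Set.Ico 0 1) := by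
    have hd : ∀ x ∈ Set.Ico (0 : ℝ) 1, HasDerivAt (fun x : ℝ => -Real.log (1 - x) - x - x ^ 2 / 2)
        (x ^ 2 / (1 - x)) x := by
      intro x hx
      have h1 : 1 - x ≠ 0 := by linarith [hx.2]
      have := (((((hasDerivAt_id x).const_sub 1).log h1).neg.sub (hasDerivAt_id x)).sub
        (((hasDerivAt_id x).pow 2).div_const 2))
      refine HasDerivAt.congr_deriv this ?_
      simp
      field_simp
      ring
    refine monotoneOn_of_deriv_nonneg (convex_Ico 0 1)
      (fun x hx => (hd x hx).continuousAt.continuousWithinAt) ?_ ?_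
    · intro x hx
      exact (hd x (interior_subset hx)).differentiableAt.differentiableWithinAt
    · intro x hx
      have hx' := interior_subset hx
      rw [(hd x hx').deriv]
      have : 0 < 1 - x := by linarith [hx'.2]
      positivity
  have := hmono ⟨hq, by linarith⟩ ⟨by linarith, hp⟩ hqp
  simp only at this
  linarith

lemma log_aux2 {s : ℝ} (h0 : 0 ≤ s) (h1 : s ≤ 1 / 8) : -s - 8 / 7 * s ^ 2 ≤ Real.log (1 - s) := by
  have h2 : 0 < 1 - s := by linarith
  have h3 := Real.one_sub_inv_le_log_of_pos h2
  have h4 : (1 - s)⁻¹ ≤ 1 + s + 8 / 7 * s ^ 2 := by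
    rw [inv_le_iff_one_le_mul₀ h2]
    nlinarith [mul_nonneg (sq_nonneg s) h0, mul_nonneg (sq_nonneg s) (sub_nonneg.2 h1)]
  linarith

lemma log_aux3 {p q : ℝ} (hq : 0 ≤ q) (hqp : q ≤ p) (hp : p < 1) :
    (p ^ 2 - q ^ 2) / 32 ≤ (Real.log (1 - q) - Real.log (1 - p)) / 8
      + Real.log (1 - (p - q) / 8) := by
  have h1 := log_aux hq hqp hp
  have h2 := log_aux2 (s := (p - q) / 8) (by linarith) (by linarith)
  nlinarith [mul_nonneg hq (sub_nonneg.2 hqp), sq_nonneg (p - q)]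

lemma pp_pos {n : ℕ} (hn : 0 < n) (α : ℝ) (i : ℕ) : 0 < pp n α i := by
  have hn' : (0 : ℝ) < n := by exact_mod_cast hn
  have := Real.rpow_pos_of_pos (idx_pos i) (1 + 2 * α)
  unfold pp; positivity

lemma pp_lt {n : ℕ} (α : ℝ) (i : ℕ) : pp n α i < 1 := by
  have hn' : (0 : ℝ) ≤ n := by positivity
  have := Real.rpow_pos_of_pos (idx_pos i) (1 + 2 * α)
  unfold pp; rw [div_lt_one (by positivity)]; linarith

lemma pp_anti {n : ℕ} (hn : 0 < n) {α α' : ℝ} (h : α ≤ α') (i : ℕ) : pp n α' i ≤ pp n α i := by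
  have hn' : (0 : ℝ) < n := by exact_mod_cast hn
  have := Real.rpow_pos_of_pos (idx_pos i) (1 + 2 * α)
  unfold pp
  gcongr
  exact idx_ge i

lemma lterm_eq {n : ℕ} (hn : 0 < n) (α : ℝ) (i : ℕ) (x : ℝ) :
    lterm n α i x = -Real.log (1 - pp n α i) - pp n α i * (n * x ^ 2) := by
  have hn' : (0 : ℝ) < n := by exact_mod_cast hn
  have := Real.rpow_pos_of_pos (idx_pos i) (1 + 2 * α)
  unfold lterm pp
  rw [← Real.log_inv]
  set a := idx i ^ (1 + 2 * α)
  congr 1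
  · congr 1
    have : 1 - (n : ℝ) / (a + n) = a / (a + n) := by field_simp; ring
    rw [this, inv_div, add_div, div_self (by positivity)]
  · field_simp

lemma coord_mgf {n : ℕ} (hn : 0 < n) {α α' : ℝ} (h : α ≤ α') (i : ℕ) (θ : ℝ) :
    ∫⁻ x, ENNReal.ofReal (Real.exp (-(1 / 16) * (lterm n α i x - lterm n α' i x)))
      ∂(gaussianReal θ ((n : ℝ≥0))⁻¹)
    ≤ ENNReal.ofReal (Real.exp (-(1 / 64) * ((pp n α i ^ 2 - 8 * pp n α i * (n * θ ^ 2))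
        - (pp n α' i ^ 2 - 8 * pp n α' i * (n * θ ^ 2))))) := by
  have hq := pp_pos hn α' i
  have hp := pp_lt (n := n) α i
  have hqp := pp_anti hn h i
  simp_rw [lterm_eq hn]
  set p := pp n α i
  set q := pp n α' i
  have hs : (p - q) / 8 < 1 := by linarith
  have e : ∀ x : ℝ, ENNReal.ofReal (Real.exp (-(1 / 16) * (-Real.log (1 - p) - p * (n * x ^ 2)
      - (-Real.log (1 - q) - q * (n * x ^ 2)))))
      = ENNReal.ofReal (Real.exp (-(1 / 16) * (Real.log (1 - q) - Real.log (1 - p))))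
        * ENNReal.ofReal (Real.exp (((p - q) / 8) * (n * x ^ 2) / 2)) := by
    intro x
    rw [← ENNReal.ofReal_mul (Real.exp_pos _).le, ← Real.exp_add]
    congr 2
    ring
  simp_rw [e]
  rw [lintegral_const_mul _ (by fun_prop), gauss_mgf θ _ n hn hs,
    ← ENNReal.ofReal_mul (Real.exp_pos _).le]
  apply ENNReal.ofReal_le_ofReal
  have hs' : 0 < 1 - (p - q) / 8 := by linarith
  have e3 : (√(1 - (p - q) / 8))⁻¹ = Real.exp (-(1 / 2) * Real.log (1 - (p - q) / 8)) := by
    rw [Real.sqrt_eq_rpow, ← Real.rpow_neg hs'.le, Real.rpow_def_of_pos hs']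
    congr 1; ring
  rw [e3, ← Real.exp_add, ← Real.exp_add, Real.exp_le_exp]
  have h3 := log_aux3 hq.le hqp hp
  have h4 : (p - q) / 8 * (n * θ ^ 2) / (2 * (1 - (p - q) / 8)) ≤ (p - q) / 8 * (n * θ ^ 2) := by
    apply div_le_self
    · have : 0 ≤ p - q := by linarith
      positivity
    · linarith
  linarith

lemma meas_lterm (n : ℕ) (α : ℝ) (i : ℕ) : Measurable (lterm n α i) := by
  unfold lterm; fun_prop

lemma fin_mgf {n : ℕ} (hn : 0 < n) {α α' : ℝ} (h : α ≤ α') (θ0 : ℕ → ℝ) (P : Measure (ℕ → ℝ))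
    (hP : IsObsLaw n θ0 P) (J : ℕ) :
    ∫⁻ X, ENNReal.ofReal (Real.exp (-(1 / 16) * ∑ i ∈ Finset.range J,
      (lterm n α i (X i) - lterm n α' i (X i)))) ∂P
    ≤ ENNReal.ofReal (Real.exp (-(1 / 64) * (HJ n θ0 J α - HJ n θ0 J α'))) := by
  have e : ∀ X : ℕ → ℝ, ENNReal.ofReal (Real.exp (-(1 / 16) * ∑ i ∈ Finset.range J,
      (lterm n α i (X i) - lterm n α' i (X i))))
      = ∏ i ∈ Finset.range J, ENNReal.ofReal (Real.exp (-(1 / 16) *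
        (lterm n α i (X i) - lterm n α' i (X i)))) := by
    intro X
    rw [Finset.mul_sum, Real.exp_sum, ENNReal.ofReal_prod_of_nonneg (fun _ _ => (Real.exp_pos _).le)]
  simp_rw [e]
  rw [obs_prod n θ0 P hP (fun i x => ENNReal.ofReal (Real.exp (-(1 / 16) *
        (lterm n α i x - lterm n α' i x)))) (fun i => by
          have := meas_lterm n α i
          have := meas_lterm n α' i
          fun_prop)]
  unfold HJ
  rw [← Finset.sum_sub_distrib, Finset.mul_sum, Real.exp_sum,
    ENNReal.ofReal_prod_of_nonneg (fun _ _ => (Real.exp_pos _).le)]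
  exact Finset.prod_le_prod' fun i _ => coord_mgf hn h i (θ0 i)

/-- `X` is regular enough for all log-likelihoods with `α ≥ D` to converge. -/
def GoodX (D : ℝ) (X : ℕ → ℝ) : Prop :=
  Summable (fun i => (idx i) ^ (-(1 + 2 * D)) * X i ^ 2)

lemma summable_idx {r : ℝ} (hr : 1 < r) : Summable (fun i => (idx i) ^ (-r)) := by
  have h := (summable_nat_add_iff 1).2 (Real.summable_nat_rpow (p := -r) |>.2 (by linarith))
  refine h.congr fun i => ?_
  unfold idx; push_cast; rfl

lemma idx_inv_le {D α : ℝ} (h : D ≤ α) (i : ℕ) :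
    ((idx i) ^ (1 + 2 * α))⁻¹ ≤ (idx i) ^ (-(1 + 2 * D)) := by
  rw [← Real.rpow_neg (idx_pos i).le]
  exact Real.rpow_le_rpow_of_exponent_le (idx_ge i) (by linarith)

lemma lterm_bound {n : ℕ} {D α : ℝ} (h : D ≤ α) (i : ℕ) (x : ℝ) :
    ‖lterm n α i x‖ ≤ n * (idx i) ^ (-(1 + 2 * D)) + n ^ 2 * ((idx i) ^ (-(1 + 2 * D)) * x ^ 2) := by
  have hn' : (0 : ℝ) ≤ n := by positivity
  have ha := Real.rpow_pos_of_pos (idx_pos i) (1 + 2 * α)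
  have hi := idx_inv_le h i
  have h1 : 0 ≤ Real.log (1 + (n : ℝ) / (idx i) ^ (1 + 2 * α)) :=
    Real.log_nonneg (by linarith [div_nonneg hn' ha.le])
  have h2 : Real.log (1 + (n : ℝ) / (idx i) ^ (1 + 2 * α)) ≤ n * (idx i) ^ (-(1 + 2 * D)) := by
    have h0 : 0 ≤ (n : ℝ) / (idx i) ^ (1 + 2 * α) := div_nonneg hn' ha.le
    calc _ ≤ (1 + (n : ℝ) / (idx i) ^ (1 + 2 * α)) - 1 := Real.log_le_sub_one_of_pos (by linarith)
      _ = n * ((idx i) ^ (1 + 2 * α))⁻¹ := by rw [div_eq_mul_inv]; ring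
      _ ≤ _ := by gcongr
  have h3 : (n : ℝ) ^ 2 * x ^ 2 / ((idx i) ^ (1 + 2 * α) + n)
      ≤ n ^ 2 * ((idx i) ^ (-(1 + 2 * D)) * x ^ 2) := by
    calc _ ≤ (n : ℝ) ^ 2 * x ^ 2 / (idx i) ^ (1 + 2 * α) := by gcongr; linarith
      _ = (n : ℝ) ^ 2 * (((idx i) ^ (1 + 2 * α))⁻¹ * x ^ 2) := by rw [div_eq_mul_inv]; ring
      _ ≤ _ := by gcongr
  have h4 : 0 ≤ (n : ℝ) ^ 2 * x ^ 2 / ((idx i) ^ (1 + 2 * α) + n) := by positivity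
  rw [Real.norm_eq_abs, abs_le]
  unfold lterm
  constructor <;> linarith

lemma bound_summable {D : ℝ} (hD : 0 < D) (n : ℕ) {X : ℕ → ℝ} (hX : GoodX D X) :
    Summable (fun i => n * (idx i) ^ (-(1 + 2 * D)) + n ^ 2 * ((idx i) ^ (-(1 + 2 * D)) * X i ^ 2)) :=
  ((summable_idx (by linarith)).mul_left _).add (hX.mul_left _)

lemma lterm_summable {D : ℝ} (hD : 0 < D) (n : ℕ) {X : ℕ → ℝ} (hX : GoodX D X) {α : ℝ} (h : D ≤ α) :
    Summable (fun i => lterm n α i (X i)) :=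
  Summable.of_norm_bounded (bound_summable hD n hX) (fun i => lterm_bound h i (X i))

lemma logLik_cont {D : ℝ} (hD : 0 < D) (n : ℕ) {X : ℕ → ℝ} (hX : GoodX D X) :
    ContinuousOn (fun α => logLik n α X) (Set.Ici D) := by
  simp_rw [logLik_eq]
  refine ContinuousOn.mul continuousOn_const ?_
  refine continuousOn_tsum (fun i => ?_) (bound_summable hD n hX) (fun i α hα => lterm_bound hα i (X i))
  apply Continuous.continuousOn
  unfold lterm
  have hc : Continuous fun α : ℝ => idx i ^ (1 + 2 * α) :=
    Continuous.rpow continuous_const (by fun_prop) (fun _ => Or.inl (idx_pos i).ne')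
  have hpos : ∀ α : ℝ, 0 < idx i ^ (1 + 2 * α) := fun α => Real.rpow_pos_of_pos (idx_pos i) _
  refine Continuous.sub (Continuous.log ?_ ?_) ?_
  · exact continuous_const.add (continuous_const.div hc (fun α => (hpos α).ne'))
  · intro α
    have := hpos α
    positivity
  · refine continuous_const.div (hc.add continuous_const) (fun α => ?_)
    have := hpos α
    positivity

lemma log_summable {D : ℝ} (hD : 0 < D) : Summable (fun i => (idx i) ^ (-(1 + D)) * Real.log (idx i)) := by
  have h := (summable_idx (r := 1 + D / 2) (by linarith)).mul_right ((D / 2)⁻¹)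
  refine Summable.of_nonneg_of_le (fun i => ?_) (fun i => ?_) h
  · exact mul_nonneg (Real.rpow_nonneg (idx_pos i).le _) (Real.log_nonneg (idx_ge i))
  · have h1 := Real.log_le_rpow_div (idx_pos i).le (ε := D / 2) (by linarith)
    calc _ ≤ (idx i) ^ (-(1 + D)) * ((idx i) ^ (D / 2) / (D / 2)) := by
            gcongr; exact Real.rpow_nonneg (idx_pos i).le _
      _ = ((idx i) ^ (-(1 + D)) * (idx i) ^ (D / 2)) * (D / 2)⁻¹ := by ring
      _ = _ := by rw [← Real.rpow_add (idx_pos i)]; congr 2; ring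

lemma logLik_lip {D : ℝ} (hD : 0 < D) {n : ℕ} (hn : 0 < n) {X : ℕ → ℝ} (hX : GoodX D X) {α γ : ℝ}
    (h : D ≤ α) (hγ : α ≤ γ) :
    logLik n γ X ≤ logLik n α X
      + n * (γ - α) * ∑' i, (idx i) ^ (-(1 + 2 * D)) * Real.log (idx i) := by
  have s1 := lterm_summable hD n hX h
  have s2 := lterm_summable hD n hX (h.trans hγ)
  have s3 := (log_summable (D := 2 * D) (by linarith)).mul_left (2 * (n * (γ - α)))
  have key : ∀ i, lterm n α i (X i) - lterm n γ i (X i)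
      ≤ 2 * (n * (γ - α)) * ((idx i) ^ (-(1 + 2 * D)) * Real.log (idx i)) := by
    intro i
    have hn' : (0 : ℝ) < n := by exact_mod_cast hn
    have ha := Real.rpow_pos_of_pos (idx_pos i) (1 + 2 * α)
    have hb := Real.rpow_pos_of_pos (idx_pos i) (1 + 2 * γ)
    have hab : (idx i) ^ (1 + 2 * α) ≤ (idx i) ^ (1 + 2 * γ) :=
      Real.rpow_le_rpow_of_exponent_le (idx_ge i) (by linarith)
    have hi := idx_inv_le h i
    have hli := Real.log_nonneg (idx_ge i)
    have h1 : (n : ℝ) ^ 2 * X i ^ 2 / ((idx i) ^ (1 + 2 * γ) + n)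
        ≤ (n : ℝ) ^ 2 * X i ^ 2 / ((idx i) ^ (1 + 2 * α) + n) := by gcongr
    have h2 : Real.log (1 + (n : ℝ) / (idx i) ^ (1 + 2 * α))
        - Real.log (1 + (n : ℝ) / (idx i) ^ (1 + 2 * γ))
        ≤ n / (idx i) ^ (1 + 2 * α) - n / (idx i) ^ (1 + 2 * γ) := by
      have hA : 0 < (n : ℝ) / (idx i) ^ (1 + 2 * α) := by positivity
      have hB : 0 < (n : ℝ) / (idx i) ^ (1 + 2 * γ) := by positivity
      have hAB : (n : ℝ) / (idx i) ^ (1 + 2 * γ) ≤ (n : ℝ) / (idx i) ^ (1 + 2 * α) := by gcongr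
      rw [← Real.log_div (by positivity) (by positivity)]
      refine (Real.log_le_sub_one_of_pos (by positivity)).trans ?_
      rw [sub_le_iff_le_add, div_le_iff₀ (by positivity)]
      nlinarith
    have h3 : (n : ℝ) / (idx i) ^ (1 + 2 * γ)
        = n * ((idx i) ^ (1 + 2 * α))⁻¹ * Real.exp (-(2 * (γ - α) * Real.log (idx i))) := by
      rw [div_eq_mul_inv, ← Real.rpow_neg (idx_pos i).le, ← Real.rpow_neg (idx_pos i).le,
        Real.rpow_def_of_pos (idx_pos i), Real.rpow_def_of_pos (idx_pos i), mul_assoc, ← Real.exp_add]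
      congr 2; ring
    have h4 := Real.add_one_le_exp (-(2 * (γ - α) * Real.log (idx i)))
    have h5 : (n : ℝ) / (idx i) ^ (1 + 2 * α) - n / (idx i) ^ (1 + 2 * γ)
        ≤ (n * ((idx i) ^ (1 + 2 * α))⁻¹) * (2 * (γ - α) * Real.log (idx i)) := by
      rw [h3, div_eq_mul_inv]
      have : 0 ≤ (n : ℝ) * ((idx i) ^ (1 + 2 * α))⁻¹ := by positivity
      nlinarith
    have h6 : ((n : ℝ) * ((idx i) ^ (1 + 2 * α))⁻¹) * (2 * (γ - α) * Real.log (idx i))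
        ≤ (n * (idx i) ^ (-(1 + 2 * D))) * (2 * (γ - α) * Real.log (idx i)) := by
      have : 0 ≤ γ - α := by linarith
      gcongr
    unfold lterm
    calc _ ≤ (n * (idx i) ^ (-(1 + 2 * D))) * (2 * (γ - α) * Real.log (idx i)) := by linarith
      _ = _ := by ring
  have h2 := (s1.sub s2).tsum_le_tsum key s3
  rw [s1.tsum_sub s2, tsum_mul_left] at h2
  rw [logLik_eq, logLik_eq]
  linarith

lemma inf_mgf {D : ℝ} (hD : 0 < D) {n : ℕ} (hn : 0 < n) {α α' : ℝ} (hα : D ≤ α) (h : α ≤ α')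
    (θ0 : ℕ → ℝ) (P : Measure (ℕ → ℝ)) (hP : IsObsLaw n θ0 P) (hgood : ∀ᵐ X ∂P, GoodX D X)
    (B : ℝ) (hB : ∀ᶠ J in atTop, B ≤ HJ n θ0 J α - HJ n θ0 J α') :
    ∫⁻ X, ENNReal.ofReal (Real.exp ((1 / 8) * (logLik n α X - logLik n α' X))) ∂P
      ≤ ENNReal.ofReal (Real.exp (-(1 / 64) * B)) := by
  have hlim : ∀ᵐ X ∂P, ENNReal.ofReal (Real.exp ((1 / 8) * (logLik n α X - logLik n α' X)))
      = liminf (fun J : ℕ => ENNReal.ofReal (Real.exp (-(1 / 16) * ∑ i ∈ Finset.range J,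
      (lterm n α i (X i) - lterm n α' i (X i))))) atTop := by
    filter_upwards [hgood] with X hX
    have s1 := lterm_summable hD n hX hα
    have s2 := lterm_summable hD n hX (hα.trans h)
    have h1 := (s1.sub s2).hasSum.tendsto_sum_nat
    rw [s1.tsum_sub s2] at h1
    refine (Tendsto.liminf_eq ?_).symm
    refine (ENNReal.continuous_ofReal.tendsto _).comp ((Real.continuous_exp.tendsto _).comp ?_)
    have h2 := h1.const_mul (-(1 / 16) : ℝ)
    convert h2 using 2
    rw [logLik_eq, logLik_eq]; ring
  rw [lintegral_congr_ae hlim]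
  refine (lintegral_liminf_le (fun J => ?_)).trans ?_
  · refine ENNReal.measurable_ofReal.comp (Real.measurable_exp.comp (Measurable.const_mul ?_ _))
    refine Finset.measurable_sum _ fun i _ => ?_
    exact ((meas_lterm n α i).comp (measurable_pi_apply i)).sub
      ((meas_lterm n α' i).comp (measurable_pi_apply i))
  · refine liminf_le_of_frequently_le' (Eventually.frequently ?_)
    filter_upwards [hB] with J hJ
    refine (fin_mgf hn h θ0 P hP J).trans ?_
    apply ENNReal.ofReal_le_ofReal
    rw [Real.exp_le_exp]
    linarith

end helpers2

section helpers3

/-- gain in the derivative -/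
def FJ (n J : ℕ) (x : ℝ) : ℝ :=
  ∑ i ∈ Finset.range J, Real.log (idx i) * (pp n x i ^ 2 * (1 - pp n x i))

/-- loss in the derivative -/
def GJ (n : ℕ) (θ0 : ℕ → ℝ) (J : ℕ) (x : ℝ) : ℝ :=
  ∑ i ∈ Finset.range J, Real.log (idx i) * (pp n x i * (1 - pp n x i) * (n * θ0 i ^ 2))

lemma pp_deriv {n : ℕ} (hn : 0 < n) (i : ℕ) (x : ℝ) :
    HasDerivAt (fun α => pp n α i) (-2 * Real.log (idx i) * (pp n x i * (1 - pp n x i))) x := by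
  have hn' : (0 : ℝ) < n := by exact_mod_cast hn
  have ha := Real.rpow_pos_of_pos (idx_pos i) (1 + 2 * x)
  have h1 : HasDerivAt (fun α : ℝ => 1 + 2 * α) 2 x := by
    simpa using ((hasDerivAt_id x).const_mul 2).const_add 1
  have h2 := h1.const_rpow (idx_pos i)
  have h3 := (hasDerivAt_const x (n : ℝ)).div (h2.add_const (n : ℝ)) (by positivity)
  refine HasDerivAt.congr_deriv h3 ?_
  unfold pp
  set a := idx i ^ (1 + 2 * x)
  field_simp
  ring

lemma HJ_deriv {n : ℕ} (hn : 0 < n) (θ0 : ℕ → ℝ) (J : ℕ) (x : ℝ) :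
    HasDerivAt (HJ n θ0 J) (-(4 * FJ n J x - 16 * GJ n θ0 J x)) x := by
  have h : HasDerivAt (fun α => ∑ i ∈ Finset.range J, (pp n α i ^ 2 - 8 * pp n α i * (n * θ0 i ^ 2)))
      (∑ i ∈ Finset.range J, ((2 * pp n x i) * (-2 * Real.log (idx i) * (pp n x i * (1 - pp n x i)))
        - 8 * (-2 * Real.log (idx i) * (pp n x i * (1 - pp n x i))) * (n * θ0 i ^ 2))) x := by
    apply HasDerivAt.fun_sum
    intro i _
    have h1 := pp_deriv hn i x
    have h2 := (h1.pow 2).sub ((h1.const_mul 8).mul_const (n * θ0 i ^ 2))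
    refine HasDerivAt.congr_deriv h2 ?_
    simp
  refine HasDerivAt.congr_deriv h ?_
  unfold FJ GJ
  rw [Finset.mul_sum, Finset.mul_sum, ← Finset.sum_sub_distrib, ← Finset.sum_neg_distrib]
  refine Finset.sum_congr rfl fun i _ => ?_
  ring

lemma HJ_gap {n : ℕ} (hn : 0 < n) (θ0 : ℕ → ℝ) (J : ℕ) {D L α α' : ℝ}
    (hL : ∀ x ∈ Set.Icc D (2 * D), L ≤ 4 * FJ n J x - 16 * GJ n θ0 J x)
    (hα : D ≤ α) (hαα : α ≤ α') (hα' : α' ≤ 2 * D) :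
    L * (α' - α) ≤ HJ n θ0 J α - HJ n θ0 J α' := by
  have := (convex_Icc D (2 * D)).image_sub_le_mul_sub_of_deriv_le (f := HJ n θ0 J) (C := -L)
    (fun x _ => (HJ_deriv hn θ0 J x).continuousAt.continuousWithinAt)
    (fun x _ => (HJ_deriv hn θ0 J x).differentiableAt.differentiableWithinAt)
    (fun x hx => by
      rw [(HJ_deriv hn θ0 J x).deriv]
      linarith [hL x (interior_subset hx)])
    α ⟨hα, hαα.trans hα'⟩ α' ⟨hα.trans hαα, hα'⟩ hαα
  linarith

lemma pow_m {n : ℕ} {x : ℝ} (hx : 0 < x) : ((n : ℝ) ^ (1 / (1 + 2 * x))) ^ (1 + 2 * x) = n := by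
  rw [← Real.rpow_mul (by positivity), one_div, inv_mul_cancel₀ (by positivity), Real.rpow_one]

lemma F_lower {D : ℝ} (hD : 0 < D) : ∃ cF : ℝ, 0 < cF ∧ ∀ n : ℕ, 1 ≤ n →
    4 ≤ (n : ℝ) ^ (1 / (1 + 4 * D)) → ∀ x ∈ Set.Icc D (2 * D), ∀ J : ℕ, 2 * n ≤ J →
      cF * (n : ℝ) ^ (1 / (1 + 2 * x)) * Real.log n ≤ FJ n J x := by
  set p0 : ℝ := 1 / (2 ^ (1 + 4 * D) + 1) with hp0
  have h2p : (0 : ℝ) < 2 ^ (1 + 4 * D) := by positivity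
  have hp0' : 0 < p0 := by positivity
  refine ⟨p0 ^ 2 / (4 * (1 + 4 * D)), by positivity, ?_⟩
  intro n hn h4 x hx J hJ
  have hn1 : (1 : ℝ) ≤ n := by exact_mod_cast hn
  have hn0 : (0 : ℝ) < n := by linarith
  have hx0 : 0 < x := lt_of_lt_of_le hD hx.1
  have hx2 := hx.2
  set m : ℝ := (n : ℝ) ^ (1 / (1 + 2 * x)) with hm
  have hmn : m ^ (1 + 2 * x) = n := pow_m hx0
  have hm4 : 4 ≤ m := by
    refine h4.trans (Real.rpow_le_rpow_of_exponent_le hn1 ?_)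
    apply one_div_le_one_div_of_le <;> linarith
  have hmlen : m ≤ n := by
    calc m ≤ (n : ℝ) ^ (1 : ℝ) := by
          refine Real.rpow_le_rpow_of_exponent_le hn1 ?_
          rw [div_le_one (by linarith)]; linarith
      _ = n := Real.rpow_one _
  have hlogm : Real.log n / (1 + 4 * D) ≤ Real.log m := by
    rw [hm, Real.log_rpow hn0]
    have := Real.log_nonneg hn1
    rw [one_div, mul_comm (_⁻¹), ← div_eq_mul_inv]
    exact div_le_div_of_nonneg_left this (by linarith) (by linarith)
  set S : Finset ℕ := Finset.Ico ⌈m⌉₊ ⌊2 * m⌋₊ with hS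
  have hSsub : S ⊆ Finset.range J := by
    intro i hi
    rw [hS, Finset.mem_Ico] at hi
    rw [Finset.mem_range]
    have : ⌊2 * m⌋₊ ≤ 2 * n := by
      have h1 : ⌊2 * m⌋₊ ≤ ⌊((2 * n : ℕ) : ℝ)⌋₊ := by
        apply Nat.floor_mono; push_cast; linarith
      rwa [Nat.floor_natCast] at h1
    omega
  have hcard : m / 2 ≤ (S.card : ℝ) := by
    rw [hS, Nat.card_Ico]
    have h1 : (⌊2 * m⌋₊ : ℝ) > 2 * m - 1 := by
      have := Nat.lt_floor_add_one (2 * m); linarith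
    have h2 : (⌈m⌉₊ : ℝ) < m + 1 := Nat.ceil_lt_add_one (by linarith)
    have h3 : (⌊2 * m⌋₊ : ℝ) ≤ ((⌊2 * m⌋₊ - ⌈m⌉₊ : ℕ) : ℝ) + ⌈m⌉₊ := by
      exact_mod_cast le_tsub_add
    linarith
  have hterm : ∀ i ∈ S, (Real.log n / (1 + 4 * D)) * (p0 ^ 2 * (1 / 2))
      ≤ Real.log (idx i) * (pp n x i ^ 2 * (1 - pp n x i)) := by
    intro i hi
    rw [hS, Finset.mem_Ico] at hi
    have h1 : m ≤ idx i := by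
      have : m ≤ (i : ℝ) := (Nat.le_ceil m).trans (by exact_mod_cast hi.1)
      unfold idx; linarith
    have h2 : idx i ≤ 2 * m := by
      have h3 : ((i + 1 : ℕ) : ℝ) ≤ ⌊2 * m⌋₊ := by exact_mod_cast hi.2
      have h4 : (⌊2 * m⌋₊ : ℝ) ≤ 2 * m := Nat.floor_le (by linarith)
      unfold idx; push_cast at h3; linarith
    have ha1 : (n : ℝ) ≤ idx i ^ (1 + 2 * x) := by
      rw [← hmn]; exact Real.rpow_le_rpow (by linarith) h1 (by linarith)
    have ha2 : idx i ^ (1 + 2 * x) ≤ 2 ^ (1 + 4 * D) * n := by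
      calc idx i ^ (1 + 2 * x) ≤ (2 * m) ^ (1 + 2 * x) :=
            Real.rpow_le_rpow (idx_pos i).le h2 (by linarith)
        _ = 2 ^ (1 + 2 * x) * n := by rw [Real.mul_rpow (by norm_num) (by linarith), hmn]
        _ ≤ _ := mul_le_mul_of_nonneg_right
          (Real.rpow_le_rpow_of_exponent_le (by norm_num) (by linarith)) hn0.le
    have ha0 := Real.rpow_pos_of_pos (idx_pos i) (1 + 2 * x)
    have hp : p0 ≤ pp n x i := by
      unfold pp
      rw [hp0, div_le_div_iff₀ (by positivity) (by positivity)]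
      nlinarith
    have hp2 : pp n x i ≤ 1 / 2 := by
      unfold pp
      rw [div_le_div_iff₀ (by positivity) (by positivity)]
      linarith
    have hl : Real.log n / (1 + 4 * D) ≤ Real.log (idx i) :=
      hlogm.trans (Real.log_le_log (by linarith) h1)
    have := Real.log_nonneg (idx_ge i)
    gcongr
    linarith
  calc p0 ^ 2 / (4 * (1 + 4 * D)) * m * Real.log n
      = (m / 2) * ((Real.log n / (1 + 4 * D)) * (p0 ^ 2 * (1 / 2))) := by field_simp; ring
    _ ≤ S.card * ((Real.log n / (1 + 4 * D)) * (p0 ^ 2 * (1 / 2))) := by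
        have := Real.log_nonneg hn1
        gcongr
    _ ≤ ∑ i ∈ S, Real.log (idx i) * (pp n x i ^ 2 * (1 - pp n x i)) := by
        rw [← nsmul_eq_mul]; exact Finset.card_nsmul_le_sum _ _ _ hterm
    _ ≤ FJ n J x := by
        refine Finset.sum_le_sum_of_subset_of_nonneg hSsub fun i _ _ => ?_
        have h1 := pp_pos hn x i
        have h2 := pp_lt (n := n) x i
        exact mul_nonneg (Real.log_nonneg (idx_ge i)) (mul_nonneg (sq_nonneg _) (by linarith))

lemma sum_ind_le (J : ℕ) {B u : ℝ} (hB : 0 ≤ B) (hu : 0 ≤ u) :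
    ∑ i ∈ Finset.range J, (if idx i < B then u else 0) ≤ B * u := by
  rw [← Finset.sum_filter, Finset.sum_const, nsmul_eq_mul]
  gcongr
  have h1 : (Finset.range J).filter (fun i => idx i < B) ⊆ Finset.range ⌊B⌋₊ := by
    intro i hi
    rw [Finset.mem_filter] at hi
    rw [Finset.mem_range]
    have h2 := hi.2
    unfold idx at h2
    exact Nat.le_floor (by push_cast; exact h2.le)
  have h3 := Finset.card_le_card h1
  rw [Finset.card_range] at h3
  exact (by exact_mod_cast h3 : _ ≤ (⌊B⌋₊ : ℝ)).trans (Nat.floor_le hB)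

set_option maxHeartbeats 1600000 in
lemma G_upper {D : ℝ} (hD : 0 < D) : ∃ CG : ℝ, 0 < CG ∧ ∀ (β K : ℝ) (nseq : ℕ → ℕ) (j : ℕ),
    D < β → β < 2 * D → 0 < K → StrictMono nseq → 1 ≤ nseq j → 
    (nseq j : ℝ) ^ (1 + 4 * D) ≤ nseq (j + 1) → 
    (nseq (j + 1) : ℝ) ^ (1 + 4 * D) ≤ nseq (j + 2) → 1 ≤ Real.log (nseq (j + 1)) →
    ∀ x ∈ Set.Icc D (2 * D), ∀ J : ℕ,
      GJ (nseq (j + 1)) (counterSignal β K nseq) J x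
        ≤ CG * K * (nseq (j + 1) : ℝ) ^ (1 / (1 + 2 * x)) * Real.log (nseq (j + 1)) := by
  set e : ℝ := 1 / (1 + 4 * D) with he
  set δ : ℝ := 4 * D + e - 1 with hδ
  have hδ0 : 0 < δ := by
    have : δ = 16 * D ^ 2 / (1 + 4 * D) := by rw [hδ, he]; field_simp; ring
    rw [this]; positivity
  have hvs := log_summable hδ0
  have hv0 : ∀ i, 0 ≤ (idx i) ^ (-(1 + δ)) * Real.log (idx i) := fun i =>
    mul_nonneg (Real.rpow_nonneg (idx_pos i).le _) (Real.log_nonneg (idx_ge i))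
  set S2 : ℝ := ∑' i, (idx i) ^ (-(1 + δ)) * Real.log (idx i) with hS2
  have hS20 : 0 ≤ S2 := tsum_nonneg hv0
  refine ⟨2 * 2 ^ (1 + 2 * D) + 4 + S2, by positivity, ?_⟩
  intro β K nseq j hβ1 hβ2 hK hmono hj1 hprev hnext hlog x hx J
  set n := nseq (j + 1) with hn
  set n1 := nseq j with hn1
  have hn1' : (1 : ℝ) ≤ n1 := by exact_mod_cast hj1
  have hn1n : n1 < n := hmono (Nat.lt_succ_self j)
  have hn1n' : (n1 : ℝ) < n := by exact_mod_cast hn1n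
  have hnpos : 0 < n := by omega
  have hn1r : (1 : ℝ) ≤ n := by linarith
  have hn0 : (0 : ℝ) < n := by linarith
  have hx0 : 0 < x := lt_of_lt_of_le hD hx.1
  have hx1 := hx.1
  have hx2 := hx.2
  set m : ℝ := (n : ℝ) ^ (1 / (1 + 2 * x)) with hm
  have hmn : m ^ (1 + 2 * x) = n := pow_m hx0
  have hm0 : 0 < m := Real.rpow_pos_of_pos hn0 _
  have hem : (n : ℝ) ^ e ≤ m := by
    refine Real.rpow_le_rpow_of_exponent_le hn1r ?_
    apply one_div_le_one_div_of_le <;> linarith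
  set B : ℝ := 2 * blockEdge β n1 with hB
  set N : ℝ := blockEdge β n with hN
  have hNn : N ^ (1 + 2 * β) = n := pow_m (by linarith)
  have hN0 : 0 < N := Real.rpow_pos_of_pos hn0 _
  have hB0 : 0 < B := mul_pos two_pos (Real.rpow_pos_of_pos (by linarith) _)
  have hβe : 1 / (1 + 2 * β) ≤ 1 := by rw [div_le_one (by linarith)]; linarith
  have hNlen : N ≤ n := by
    calc N ≤ (n : ℝ) ^ (1 : ℝ) := Real.rpow_le_rpow_of_exponent_le hn1r hβe
      _ = n := Real.rpow_one _
  have hedge : ∀ a b : ℕ, a ≤ b → blockEdge β a ≤ blockEdge β b := by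
    intro a b hab
    unfold blockEdge
    refine Real.rpow_le_rpow (by positivity) (by exact_mod_cast hab) ?_
    apply div_nonneg <;> linarith
  have hB2N : B ≤ 2 * N := by
    have := hedge n1 n hn1n.le
    rw [hB]; linarith
  have hBpow : B * B ^ (2 * D) ≤ 2 ^ (1 + 2 * D) * m := by
    have h1 : B * B ^ (2 * D) = B ^ (1 + 2 * D) := by
      rw [Real.rpow_add hB0, Real.rpow_one]
    have h2 : blockEdge β n1 ^ (1 + 2 * D) ≤ n1 := by
      unfold blockEdge
      rw [← Real.rpow_mul (by positivity)]
      calc (n1 : ℝ) ^ (1 / (1 + 2 * β) * (1 + 2 * D)) ≤ (n1 : ℝ) ^ (1 : ℝ) := by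
            refine Real.rpow_le_rpow_of_exponent_le hn1' ?_
            rw [one_div, inv_mul_le_iff₀ (by linarith)]; linarith
        _ = n1 := Real.rpow_one _
    have h3 : (n1 : ℝ) ≤ (n : ℝ) ^ e := by
      calc (n1 : ℝ) = ((n1 : ℝ) ^ (1 + 4 * D)) ^ e := by
            rw [← Real.rpow_mul (by positivity), he, mul_one_div, div_self (by positivity), Real.rpow_one]
        _ ≤ _ := Real.rpow_le_rpow (by positivity) hprev (by positivity)
    rw [h1, hB, Real.mul_rpow (by norm_num) (by unfold blockEdge; positivity)]
    gcongr
    linarith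
  have hlog2 : ∀ i, idx i < 2 * N → Real.log (idx i) ≤ 2 * Real.log n := by
    intro i hi
    have h1 : Real.log (idx i) ≤ Real.log (2 * n) := Real.log_le_log (idx_pos i) (by linarith)
    rw [Real.log_mul (by norm_num) hn0.ne'] at h1
    have := Real.log_two_lt_d9
    linarith
  -- elementary bounds on `p (1 - p)`
  have hpa : ∀ i, 0 ≤ pp n x i * (1 - pp n x i) := fun i =>
    mul_nonneg (pp_pos hnpos x i).le (by linarith [pp_lt (n := n) x i])
  have hp1 : ∀ i, pp n x i * (1 - pp n x i) ≤ 1 := fun i => by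
    have h1 := pp_pos hnpos x i
    have h2 := pp_lt (n := n) x i
    nlinarith
  have hp2 : ∀ i, pp n x i * (1 - pp n x i) ≤ n / idx i ^ (1 + 2 * x) := fun i => by
    have ha := Real.rpow_pos_of_pos (idx_pos i) (1 + 2 * x)
    have h1 := pp_pos hnpos x i
    have h3 : pp n x i ≤ n / idx i ^ (1 + 2 * x) := by
      unfold pp; gcongr; linarith
    nlinarith
  have hp3 : ∀ i, pp n x i * (1 - pp n x i) ≤ idx i ^ (1 + 2 * x) / n := fun i => by
    have ha := Real.rpow_pos_of_pos (idx_pos i) (1 + 2 * x)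
    have h1 := pp_pos hnpos x i
    have h2 := pp_lt (n := n) x i
    have h3 : 1 - pp n x i ≤ idx i ^ (1 + 2 * x) / n := by
      have : 1 - pp n x i = idx i ^ (1 + 2 * x) / (idx i ^ (1 + 2 * x) + n) := by
        unfold pp; field_simp; ring
      rw [this]; gcongr; linarith
    nlinarith
  obtain ⟨E, hE0, hNE, hE⟩ : ∃ E : ℝ, 0 ≤ E ∧ N * E ≤ m ∧ ∀ i, N ≤ idx i →
      pp n x i * (1 - pp n x i) * (n * idx i ^ (-(1 + 2 * β))) ≤ E := by
    have hnN : ∀ i, N ≤ idx i → n * idx i ^ (-(1 + 2 * β)) ≤ 1 := by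
      intro i hi
      rw [Real.rpow_neg (idx_pos i).le, ← div_eq_mul_inv,
        div_le_one (Real.rpow_pos_of_pos (idx_pos i) _), ← hNn]
      exact Real.rpow_le_rpow hN0.le hi (by linarith)
    have hnp : ∀ i, 0 ≤ n * idx i ^ (-(1 + 2 * β)) := fun i =>
      mul_nonneg hn0.le (Real.rpow_nonneg (idx_pos i).le _)
    rcases le_total x β with hxb | hxb
    · refine ⟨1, zero_le_one, ?_, ?_⟩
      · rw [mul_one]
        refine Real.rpow_le_rpow_of_exponent_le hn1r ?_
        apply one_div_le_one_div_of_le <;> linarith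
      · intro i hi
        exact mul_le_one₀ (hp1 i) (hnp i) (hnN i hi)
    · refine ⟨n / N ^ (1 + 2 * x), by positivity, ?_, ?_⟩
      · have hmN : m ≤ N := by
          refine Real.rpow_le_rpow_of_exponent_le hn1r ?_
          apply one_div_le_one_div_of_le <;> linarith
        have h1 : N * (n / N ^ (1 + 2 * x)) = n / N ^ (2 * x) := by
          rw [Real.rpow_add hN0, Real.rpow_one]; field_simp
        rw [h1]
        have h2 : (n : ℝ) = m * m ^ (2 * x) := by
          rw [← hmn, Real.rpow_add hm0, Real.rpow_one]
        rw [div_le_iff₀ (by positivity)]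
        calc (n : ℝ) = m * m ^ (2 * x) := h2
          _ ≤ m * N ^ (2 * x) := by gcongr
      · intro i hi
        calc _ ≤ pp n x i * (1 - pp n x i) * 1 := by
              exact mul_le_mul_of_nonneg_left (hnN i hi) (hpa i)
          _ ≤ n / idx i ^ (1 + 2 * x) := by rw [mul_one]; exact hp2 i
          _ ≤ _ := by gcongr
  have hlogn : 0 ≤ Real.log n := by linarith
  have hterm : ∀ i, Real.log (idx i) * (pp n x i * (1 - pp n x i)
        * (n * counterSignal β K nseq i ^ 2))
      ≤ (if idx i < B then 2 * Real.log n * (K * B ^ (2 * D)) else 0)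
        + (if idx i < 2 * N then 2 * Real.log n * (K * E) else 0)
        + K * m * ((idx i) ^ (-(1 + δ)) * Real.log (idx i)) := by
    intro i
    have hli := Real.log_nonneg (idx_ge i)
    have t1 : 0 ≤ (if idx i < B then 2 * Real.log n * (K * B ^ (2 * D)) else 0) := by
      split_ifs <;> positivity
    have t2 : 0 ≤ (if idx i < 2 * N then 2 * Real.log n * (K * E) else 0) := by
      split_ifs <;> positivity
    have t3 : 0 ≤ K * m * ((idx i) ^ (-(1 + δ)) * Real.log (idx i)) :=
      mul_nonneg (by positivity) (hv0 i)
    by_cases hi : i ∈ {i : ℕ | ∃ j, blockEdge β (nseq j) ≤ idx i ∧ idx i < 2 * blockEdge β (nseq j)}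
    · have hsq : counterSignal β K nseq i ^ 2 = K * idx i ^ (-(1 + 2 * β)) := by
        unfold counterSignal
        rw [Set.indicator_of_mem hi, Real.sq_sqrt]
        exact mul_nonneg hK.le (Real.rpow_nonneg (idx_pos i).le _)
      rw [hsq]
      have e1 : pp n x i * (1 - pp n x i) * (n * (K * idx i ^ (-(1 + 2 * β))))
          = K * (pp n x i * (1 - pp n x i) * (n * idx i ^ (-(1 + 2 * β)))) := by ring
      rw [e1]
      have hnp : 0 ≤ n * idx i ^ (-(1 + 2 * β)) :=
        mul_nonneg hn0.le (Real.rpow_nonneg (idx_pos i).le _)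
      obtain ⟨k, hk1, hk2⟩ := hi
      rcases lt_trichotomy k (j + 1) with hkj | hkj | hkj
      · have hiB : idx i < B := by
          have := hedge (nseq k) n1 (hmono.monotone (by omega))
          rw [hB]; linarith
        rw [if_pos hiB] at t1 ⊢
        have h1 : pp n x i * (1 - pp n x i) * (n * idx i ^ (-(1 + 2 * β))) ≤ B ^ (2 * D) := by
          calc _ ≤ idx i ^ (1 + 2 * x) / n * (n * idx i ^ (-(1 + 2 * β))) :=
                mul_le_mul_of_nonneg_right (hp3 i) hnp
            _ = idx i ^ (1 + 2 * x) * idx i ^ (-(1 + 2 * β)) := by field_simp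
            _ = idx i ^ (2 * x - 2 * β) := by
                rw [← Real.rpow_add (idx_pos i)]; congr 1; ring
            _ ≤ idx i ^ (2 * D) := Real.rpow_le_rpow_of_exponent_le (idx_ge i) (by linarith)
            _ ≤ _ := Real.rpow_le_rpow (idx_pos i).le hiB.le (by linarith)
        have h2 := hlog2 i (by linarith)
        have h3 : Real.log (idx i) * (K * (pp n x i * (1 - pp n x i) * (n * idx i ^ (-(1 + 2 * β)))))
            ≤ 2 * Real.log n * (K * B ^ (2 * D)) := by
          have : 0 ≤ pp n x i * (1 - pp n x i) * (n * idx i ^ (-(1 + 2 * β))) := mul_nonneg (hpa i) hnp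
          gcongr
        linarith
      · subst hkj
        rw [if_pos hk2] at t2 ⊢
        have h1 := hE i hk1
        have h2 := hlog2 i hk2
        have h3 : Real.log (idx i) * (K * (pp n x i * (1 - pp n x i) * (n * idx i ^ (-(1 + 2 * β)))))
            ≤ 2 * Real.log n * (K * E) := by
          have : 0 ≤ pp n x i * (1 - pp n x i) * (n * idx i ^ (-(1 + 2 * β))) := mul_nonneg (hpa i) hnp
          gcongr
        linarith
      · have hin : (n : ℝ) ≤ idx i := by
          have h1 := hedge (nseq (j + 2)) (nseq k) (hmono.monotone (by omega))
          refine le_trans ?_ (h1.trans hk1)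
          unfold blockEdge
          calc (n : ℝ) = (n : ℝ) ^ (1 : ℝ) := (Real.rpow_one _).symm
            _ ≤ (n : ℝ) ^ ((1 + 4 * D) * (1 / (1 + 2 * β))) := by
                refine Real.rpow_le_rpow_of_exponent_le hn1r ?_
                rw [mul_one_div, le_div_iff₀ (by linarith)]; linarith
            _ = ((n : ℝ) ^ (1 + 4 * D)) ^ (1 / (1 + 2 * β)) := Real.rpow_mul hn0.le _ _
            _ ≤ _ := Real.rpow_le_rpow (by positivity) hnext (by apply div_nonneg <;> linarith)
        have he1 : e ≤ 1 := by rw [he, div_le_one (by linarith)]; linarith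
        have h1 : pp n x i * (1 - pp n x i) * (n * idx i ^ (-(1 + 2 * β)))
            ≤ m * idx i ^ (-(1 + δ)) := by
          calc _ ≤ n / idx i ^ (1 + 2 * x) * (n * idx i ^ (-(1 + 2 * β))) :=
                mul_le_mul_of_nonneg_right (hp2 i) hnp
            _ = (n : ℝ) ^ 2 * (idx i ^ (-(1 + 2 * x)) * idx i ^ (-(1 + 2 * β))) := by
                rw [Real.rpow_neg (idx_pos i).le (1 + 2 * x)]; ring
            _ = (n : ℝ) ^ e * (n : ℝ) ^ (2 - e) * idx i ^ (-(2 + 2 * x + 2 * β)) := by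
                rw [← Real.rpow_add (idx_pos i), ← Real.rpow_add hn0, ← Real.rpow_natCast]
                congr 2 <;> push_cast <;> ring
            _ ≤ m * idx i ^ (2 - e) * idx i ^ (-(2 + 4 * D)) := by
                have q1 : (n : ℝ) ^ (2 - e) ≤ idx i ^ (2 - e) :=
                  Real.rpow_le_rpow hn0.le hin (by linarith)
                have q2 : idx i ^ (-(2 + 2 * x + 2 * β)) ≤ idx i ^ (-(2 + 4 * D)) :=
                  Real.rpow_le_rpow_of_exponent_le (idx_ge i) (by linarith)
                have q3 := Real.rpow_nonneg (idx_pos i).le (-(2 + 2 * x + 2 * β))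
                have q4 := Real.rpow_nonneg (idx_pos i).le (2 - e)
                gcongr
            _ = m * idx i ^ (-(1 + δ)) := by
                rw [mul_assoc, ← Real.rpow_add (idx_pos i)]; congr 2; rw [hδ]; ring
        have h3 : Real.log (idx i) * (K * (pp n x i * (1 - pp n x i) * (n * idx i ^ (-(1 + 2 * β)))))
            ≤ Real.log (idx i) * (K * (m * idx i ^ (-(1 + δ)))) := by
          gcongr
        have h4 : Real.log (idx i) * (K * (m * idx i ^ (-(1 + δ))))
          = K * m * ((idx i) ^ (-(1 + δ)) * Real.log (idx i)) := by ring
        linarith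
    · have hz : counterSignal β K nseq i = 0 := by
        unfold counterSignal
        exact Set.indicator_of_notMem hi _
      rw [hz]
      simp only [ne_eq, OfNat.ofNat_ne_zero, not_false_eq_true, zero_pow, mul_zero]
      linarith
  unfold GJ
  refine (Finset.sum_le_sum fun i _ => hterm i).trans ?_
  rw [Finset.sum_add_distrib, Finset.sum_add_distrib, ← Finset.mul_sum]
  have s1 := sum_ind_le J hB0.le (u := 2 * Real.log n * (K * B ^ (2 * D))) (by positivity)
  have s2 := sum_ind_le J (B := 2 * N) (by linarith) (u := 2 * Real.log n * (K * E)) (by positivity)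
  have s3 : ∑ i ∈ Finset.range J, (idx i) ^ (-(1 + δ)) * Real.log (idx i) ≤ S2 :=
    hvs.sum_le_tsum _ (fun i _ => hv0 i)
  have s1' : B * (2 * Real.log n * (K * B ^ (2 * D)))
      ≤ 2 * Real.log n * K * (2 ^ (1 + 2 * D) * m) := by
    calc _ = 2 * Real.log n * K * (B * B ^ (2 * D)) := by ring
      _ ≤ _ := by gcongr
  have s2' : 2 * N * (2 * Real.log n * (K * E)) ≤ 4 * Real.log n * K * m := by
    calc _ = 4 * Real.log n * K * (N * E) := by ring
      _ ≤ _ := by gcongr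
  have s3' : K * m * (∑ i ∈ Finset.range J, (idx i) ^ (-(1 + δ)) * Real.log (idx i))
      ≤ K * m * S2 * Real.log n := by
    calc _ ≤ K * m * S2 := by gcongr
      _ ≤ _ := le_mul_of_one_le_right (by positivity) hlog
  calc _ ≤ 2 * Real.log n * K * (2 ^ (1 + 2 * D) * m) + 4 * Real.log n * K * m
        + K * m * S2 * Real.log n := by linarith
    _ = _ := by ring

end helpers3

section helpers4

lemma meas_logLik (n : ℕ) (α : ℝ) : Measurable (fun X : ℕ → ℝ => logLik n α X) := by
  simp_rw [logLik_eq]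
  refine Measurable.const_mul ?_ _
  exact Measurable.tsum fun i => (meas_lterm n α i).comp (measurable_pi_apply i)

/-- the grid cell containing a point -/
lemma grid_mem {l s a : ℝ} (hs : 0 < s) (ha : l ≤ a) (n : ℕ) (han : a ≤ l + n * s) :
    ∃ k ∈ Finset.range (n + 1), l + k * s ≤ a ∧ a ≤ l + (k + 1) * s := by
  refine ⟨⌊(a - l) / s⌋₊, ?_, ?_, ?_⟩
  · rw [Finset.mem_range, Nat.lt_succ_iff]
    have : ⌊(a - l) / s⌋₊ ≤ ⌊(n : ℝ)⌋₊ := by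
      apply Nat.floor_mono
      rw [div_le_iff₀ hs]; linarith
    rwa [Nat.floor_natCast] at this
  · have := Nat.floor_le (a := (a - l) / s) (div_nonneg (by linarith) hs.le)
    rw [le_div_iff₀ hs] at this
    linarith
  · have := Nat.lt_floor_add_one ((a - l) / s)
    rw [div_lt_iff₀ hs] at this
    linarith

lemma pigeon (lam : Measure ℝ) [IsProbabilityMeasure lam] {l u s M : ℝ} (hs : 0 < s) (n : ℕ)
    (hM : 0 ≤ M)
    (hu : u ≤ l + n * s) (hmass : ENNReal.ofReal M < lam (Set.Icc l u)) :
    ∃ k : ℕ, M / (n + 1) ≤ lam.real (Set.Icc (l + k * s) (min (l + (k + 1) * s) u)) := by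
  by_contra! hcon
  have hsub : Set.Icc l u ⊆ ⋃ k ∈ Finset.range (n + 1),
      Set.Icc (l + k * s) (min (l + (k + 1) * s) u) := by
    intro a ha
    obtain ⟨k, hk, h1, h2⟩ := grid_mem hs ha.1 n (ha.2.trans hu)
    simp only [Set.mem_iUnion]
    exact ⟨k, hk, h1, le_min h2 ha.2⟩
  have h1 := (measure_mono hsub).trans (measure_biUnion_finset_le (μ := lam) _ _)
  have h2 : ∑ k ∈ Finset.range (n + 1), lam (Set.Icc (l + k * s) (min (l + (k + 1) * s) u))
      ≤ ∑ k ∈ Finset.range (n + 1), ENNReal.ofReal (M / (n + 1)) := by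
    refine Finset.sum_le_sum fun k _ => ?_
    rw [← ofReal_measureReal]
    exact ENNReal.ofReal_le_ofReal (hcon k).le
  rw [← ENNReal.ofReal_sum_of_nonneg (fun _ _ => by positivity), Finset.sum_const, Finset.card_range,
    nsmul_eq_mul] at h2
  have h3 : ((n + 1 : ℕ) : ℝ) * (M / (n + 1)) = M := by push_cast; field_simp
  rw [h3] at h2
  exact absurd (h1.trans h2) (not_le.2 hmass)

lemma hyper_le {D : ℝ} (hD : 0 < D) (lam : Measure ℝ) [IsProbabilityMeasure lam] {n : ℕ} (hn : 0 < n)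
    {X : ℕ → ℝ} (hX : GoodX D X) {D' v w mV S : ℝ} (hD'1 : D ≤ D') (hD'2 : D' ≤ 2 * D)
    (hS : S = ∑' i, (idx i) ^ (-(1 + 2 * D)) * Real.log (idx i))
    (hv : D ≤ v) (hw : w ≤ 2 * D) (hvw : w ≤ v + D / n) (hmV : 0 < mV)
    (hmass : mV ≤ lam.real (Set.Icc v w)) :
    0 ≤ hyperProbOn lam D n X (Set.Icc D D') ∧
    hyperProbOn lam D n X (Set.Icc D D') ≤ ∑ k ∈ Finset.range (n + 1),
      (Real.exp (2 * (D * S)) / mV) ^ (1 / 8 : ℝ)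
        * Real.exp ((1 / 8) * (logLik n (min (D + k * (D / n)) D') X - logLik n w X)) := by
  have hn' : (0 : ℝ) < n := by exact_mod_cast hn
  have hs : 0 < D / n := by positivity
  have hcont := logLik_cont hD n hX
  have hS0 : 0 ≤ S := by
    rw [hS]
    exact tsum_nonneg fun i => mul_nonneg (Real.rpow_nonneg (idx_pos i).le _)
      (Real.log_nonneg (idx_ge i))
  have hint : ∀ a b : ℝ, D ≤ a → IntegrableOn (fun α => Real.exp (logLik n α X)) (Set.Icc a b) lam := by
    intro a b ha
    refine ContinuousOn.integrableOn_compact isCompact_Icc ?_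
    exact Real.continuous_exp.comp_continuousOn (hcont.mono fun y hy => ha.trans hy.1)
  have hlip : ∀ a b : ℝ, D ≤ a → a ≤ b → b ≤ a + D / n → logLik n b X ≤ logLik n a X + D * S := by
    intro a b ha hab hb
    have h1 := logLik_lip hD hn hX ha hab
    rw [← hS] at h1
    have h2 : n * (b - a) ≤ D := by
      have : b - a ≤ D / n := by linarith
      rw [le_div_iff₀ hn'] at this
      linarith
    nlinarith
  set A := ∫ α in Set.Icc D D', Real.exp (logLik n α X) ∂lam with hA
  set Z := ∫ α in Set.Icc D (2 * D), Real.exp (logLik n α X) ∂lam with hZ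
  have hA0 : 0 ≤ A := setIntegral_nonneg measurableSet_Icc fun y _ => (Real.exp_pos _).le
  have hAZ : A ≤ Z := by
    refine setIntegral_mono_set (hint D (2 * D) le_rfl) ?_ ?_
    · exact Eventually.of_forall fun y => (Real.exp_pos _).le
    · exact (Set.Icc_subset_Icc_right hD'2).eventuallyLE
  have hZlow : mV * Real.exp (logLik n w X - D * S) ≤ Z := by
    calc mV * Real.exp (logLik n w X - D * S)
        ≤ lam.real (Set.Icc v w) * Real.exp (logLik n w X - D * S) := by gcongr
      _ = ∫ α in Set.Icc v w, Real.exp (logLik n w X - D * S) ∂lam := by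
          rw [setIntegral_const, smul_eq_mul]
      _ ≤ ∫ α in Set.Icc v w, Real.exp (logLik n α X) ∂lam := by
          refine setIntegral_mono_on (integrableOn_const (measure_ne_top _ _)) (hint v w hv) measurableSet_Icc ?_
          intro y hy
          rw [Real.exp_le_exp]
          have := hlip y w (hv.trans hy.1) hy.2 (by linarith [hy.1])
          linarith
      _ ≤ Z := by
          refine setIntegral_mono_set (hint D (2 * D) le_rfl) ?_ ?_
          · exact Eventually.of_forall fun y => (Real.exp_pos _).le
          · exact (Set.Icc_subset_Icc hv hw).eventuallyLE
  have hZ0 : 0 < Z := lt_of_lt_of_le (by positivity) hZlow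
  have hval : hyperProbOn lam D n X (Set.Icc D D') = A / Z := rfl
  rw [hval]
  refine ⟨div_nonneg hA0 hZ0.le, ?_⟩
  obtain ⟨k0, hk0, hmax⟩ := Finset.exists_max_image (Finset.range (n + 1))
    (fun k : ℕ => logLik n (min (D + k * (D / n)) D') X) ⟨0, by simp⟩
  have hAup : A ≤ Real.exp (logLik n (min (D + k0 * (D / n)) D') X + D * S) := by
    calc A ≤ ∫ α in Set.Icc D D', Real.exp (logLik n (min (D + k0 * (D / n)) D') X + D * S) ∂lam := by
          refine setIntegral_mono_on (hint D D' le_rfl) (integrableOn_const (measure_ne_top _ _)) measurableSet_Icc ?_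
          intro y hy
          rw [Real.exp_le_exp]
          have hnn : (n : ℝ) * (D / n) = D := by field_simp
          obtain ⟨k, hk, h1, h2⟩ := grid_mem hs hy.1 n (by linarith [hy.2])
          have h3 := hmax k hk
          have h4 := hlip (min (D + k * (D / n)) D') y
            (le_min (by have : 0 ≤ (k : ℝ) * (D / n) := by positivity
                        linarith) hD'1)
            ((min_le_left _ _).trans h1)
            (by rcases min_choice (D + k * (D / n)) D' with h | h <;> rw [h]
                · linarith
                · linarith [hy.2])
          linarith
      _ = lam.real (Set.Icc D D') * Real.exp (logLik n (min (D + k0 * (D / n)) D') X + D * S) := by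
          rw [setIntegral_const, smul_eq_mul]
      _ ≤ 1 * Real.exp (logLik n (min (D + k0 * (D / n)) D') X + D * S) := by
          gcongr
          exact measureReal_le_one
      _ = _ := one_mul _
  have hy0 : 0 ≤ A / Z := div_nonneg hA0 hZ0.le
  have hy1 : A / Z ≤ 1 := (div_le_one hZ0).2 hAZ
  have hy2 : A / Z ≤ (Real.exp (2 * (D * S)) / mV)
      * Real.exp (logLik n (min (D + k0 * (D / n)) D') X - logLik n w X) := by
    calc A / Z ≤ Real.exp (logLik n (min (D + k0 * (D / n)) D') X + D * S)
          / (mV * Real.exp (logLik n w X - D * S)) := by gcongr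
      _ = _ := by
        rw [div_mul_eq_mul_div, ← Real.exp_add, div_mul_eq_div_div_swap, ← Real.exp_sub]
        congr 2
        ring
  calc A / Z ≤ (A / Z) ^ (1 / 8 : ℝ) := by
        rcases hy0.eq_or_lt with h | h
        · rw [← h]; positivity
        · exact Real.self_le_rpow_of_le_one hy0 hy1 (by norm_num)
    _ ≤ ((Real.exp (2 * (D * S)) / mV)
      * Real.exp (logLik n (min (D + k0 * (D / n)) D') X - logLik n w X)) ^ (1 / 8 : ℝ) :=
        Real.rpow_le_rpow hy0 hy2 (by norm_num)
    _ = (Real.exp (2 * (D * S)) / mV) ^ (1 / 8 : ℝ)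
        * Real.exp ((1 / 8) * (logLik n (min (D + k0 * (D / n)) D') X - logLik n w X)) := by
        rw [Real.mul_rpow (by positivity) (Real.exp_pos _).le, ← Real.exp_mul]
        congr 2
        ring
    _ ≤ _ := Finset.single_le_sum (f := fun k : ℕ => (Real.exp (2 * (D * S)) / mV) ^ (1 / 8 : ℝ)
        * Real.exp ((1 / 8) * (logLik n (min (D + k * (D / n)) D') X - logLik n w X)))
        (fun k _ => by positivity) hk0

lemma integral_le_of_lintegral {Ω : Type*} [MeasurableSpace Ω] (P : Measure Ω) (f : Ω → ℝ)
    (g : Ω → ℝ≥0∞) (hf : ∀ᵐ x ∂P, 0 ≤ f x) (hfg : ∀ᵐ x ∂P, ENNReal.ofReal (f x) ≤ g x) {b : ℝ}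
    (hb : 0 ≤ b) (hg : ∫⁻ x, g x ∂P ≤ ENNReal.ofReal b) : ∫ x, f x ∂P ≤ b := by
  by_cases hm : AEStronglyMeasurable f P
  · rw [integral_eq_lintegral_of_nonneg_ae hf hm]
    exact ENNReal.toReal_le_of_le_ofReal hb ((lintegral_mono_ae hfg).trans hg)
  · rw [integral_non_aestronglyMeasurable hm]
    exact hb

/-- non-asymptotic bound -/
lemma main_bound {D : ℝ} (hD : 0 < D) (lam : Measure ℝ) [IsProbabilityMeasure lam] {n : ℕ} (hn : 0 < n)
    (θ0 : ℕ → ℝ) (P : Measure (ℕ → ℝ)) (hP : IsObsLaw n θ0 P) (hgood : ∀ᵐ X ∂P, GoodX D X)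
    {D' v w mV S : ℝ} (hD'1 : D ≤ D') (hD'2 : D' ≤ 2 * D)
    (hS : S = ∑' i, (idx i) ^ (-(1 + 2 * D)) * Real.log (idx i))
    (hv : D ≤ v) (hw : w ≤ 2 * D) (hvw : w ≤ v + D / n) (hD'w : D' ≤ w) (hmV : 0 < mV)
    (hmass : mV ≤ lam.real (Set.Icc v w)) (B : ℝ)
    (hB : ∀ α, D ≤ α → α ≤ D' → ∀ᶠ J in atTop, B ≤ HJ n θ0 J α - HJ n θ0 J w) :
    ∫ X, hyperProbOn lam D n X (Set.Icc D D') ∂P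
      ≤ (n + 1) * ((Real.exp (2 * (D * S)) / mV) ^ (1 / 8 : ℝ) * Real.exp (-(1 / 64) * B)) := by
  set Q := (Real.exp (2 * (D * S)) / mV) ^ (1 / 8 : ℝ) with hQ
  have hQ0 : 0 ≤ Q := by positivity
  refine integral_le_of_lintegral P _ (fun X => ∑ k ∈ Finset.range (n + 1), ENNReal.ofReal Q
    * ENNReal.ofReal (Real.exp ((1 / 8) * (logLik n (min (D + k * (D / n)) D') X - logLik n w X))))
    ?_ ?_ (by positivity) ?_
  · filter_upwards [hgood] with X hX
    exact (hyper_le hD lam hn hX hD'1 hD'2 hS hv hw hvw hmV hmass).1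
  · filter_upwards [hgood] with X hX
    refine (ENNReal.ofReal_le_ofReal
      (hyper_le hD lam hn hX hD'1 hD'2 hS hv hw hvw hmV hmass).2).trans ?_
    rw [ENNReal.ofReal_sum_of_nonneg (fun k _ => by positivity)]
    refine Finset.sum_le_sum fun k _ => ?_
    rw [ENNReal.ofReal_mul hQ0]
  · have hme : ∀ α, Measurable (fun X : ℕ → ℝ => ENNReal.ofReal
        (Real.exp ((1 / 8) * (logLik n α X - logLik n w X)))) := fun α =>
      ENNReal.measurable_ofReal.comp (Real.measurable_exp.comp
        (((meas_logLik n α).sub (meas_logLik n w)).const_mul _))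
    rw [lintegral_finsetSum _ (fun k _ => (hme _).const_mul _)]
    have h1 : ∀ k ∈ Finset.range (n + 1), ∫⁻ X, ENNReal.ofReal Q * ENNReal.ofReal (Real.exp ((1 / 8) *
        (logLik n (min (D + k * (D / n)) D') X - logLik n w X))) ∂P
        ≤ ENNReal.ofReal (Q * Real.exp (-(1 / 64) * B)) := by
      intro k _
      rw [lintegral_const_mul _ (hme _), ENNReal.ofReal_mul hQ0]
      gcongr
      have hk : D ≤ min (D + k * (D / n)) D' :=
        le_min (by have : 0 ≤ (k : ℝ) * (D / n) := by positivity
                   linarith) hD'1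
      exact inf_mgf hD hn hk ((min_le_right _ _).trans hD'w) θ0 P hP hgood B
        (hB _ hk (min_le_right _ _))
    refine (Finset.sum_le_sum h1).trans ?_
    rw [← ENNReal.ofReal_sum_of_nonneg (fun _ _ => by positivity), Finset.sum_const,
      Finset.card_range, nsmul_eq_mul]
    push_cast
    exact le_rfl

end helpers4

section helpers5

lemma counter_sq_le {D β K : ℝ} (hD : 0 < D) (hβ : D < β) (hK : 0 < K) (nseq : ℕ → ℕ) (i : ℕ) :
    counterSignal β K nseq i ^ 2 ≤ K := by
  unfold counterSignal
  by_cases h : i ∈ {i : ℕ | ∃ j, blockEdge β (nseq j) ≤ idx i ∧ idx i < 2 * blockEdge β (nseq j)}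
  · rw [Set.indicator_of_mem h]
    have h0 : 0 ≤ (idx i) ^ (-(1 + 2 * β)) := (Real.rpow_pos_of_pos (idx_pos i) _).le
    have h1 : (idx i) ^ (-(1 + 2 * β)) ≤ 1 :=
      Real.rpow_le_one_of_one_le_of_nonpos (idx_ge i) (by linarith)
    rw [Real.sq_sqrt (by positivity)]
    nlinarith
  · rw [Set.indicator_of_notMem h]
    simpa using hK.le

lemma final_numeric {E Q N l cF m mV : ℝ} (hQ : Q = E * 2 / mV) (hE : 0 < E) (hmV : 0 < mV)
    (hN : 1 ≤ N) (hl : 1 ≤ l)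
    (h1 : N ^ 2 * Real.exp (-(cF / 128) * m) ≤ 1) :
    (N + 1) * ((E / (mV / (2 * l) / (N + 1))) ^ (1 / 8 : ℝ) * Real.exp (-(1 / 64) * (cF * m)))
      ≤ 4 * (1 + Q) * Real.exp (-(cF / 128) * m) * l := by
  have hQ0 : 0 < Q := by rw [hQ]; positivity
  have hy : E / (mV / (2 * l) / (N + 1)) = Q * (N + 1) * l := by
    rw [hQ]; field_simp
  rw [hy]
  set y := Q * (N + 1) * l with hyd
  have hy0 : 0 ≤ y := by positivity
  have hy1 : y ^ (1 / 8 : ℝ) ≤ 1 + y := by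
    calc y ^ (1 / 8 : ℝ) ≤ (1 + y) ^ (1 / 8 : ℝ) :=
          Real.rpow_le_rpow hy0 (by linarith) (by norm_num)
      _ ≤ (1 + y) ^ (1 : ℝ) := Real.rpow_le_rpow_of_exponent_le (by linarith) (by norm_num)
      _ = 1 + y := Real.rpow_one _
  set e := Real.exp (-(cF / 128) * m) with he
  have he0 : 0 < e := Real.exp_pos _
  have hee : Real.exp (-(1 / 64) * (cF * m)) = e * e := by
    rw [he, ← Real.exp_add]; congr 1; ring
  rw [hee]
  have h2 : (N + 1) * (1 + y) ≤ 4 * (1 + Q) * l * N ^ 2 := by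
    have ha : (1:ℝ) + y ≤ (1 + Q) * (N + 1) * l := by
      have : 1 ≤ (N + 1) * l := by nlinarith
      rw [hyd]; nlinarith
    calc (N + 1) * (1 + y) ≤ (N + 1) * ((1 + Q) * (N + 1) * l) := by gcongr
      _ = (N + 1) ^ 2 * ((1 + Q) * l) := by ring
      _ ≤ (2 * N) ^ 2 * ((1 + Q) * l) := by gcongr; linarith
      _ = _ := by ring
  calc (N + 1) * (y ^ (1 / 8 : ℝ) * (e * e)) ≤ (N + 1) * ((1 + y) * (e * e)) := by gcongr
    _ = ((N + 1) * (1 + y)) * (e * e) := by ring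
    _ ≤ (4 * (1 + Q) * l * N ^ 2) * (e * e) := by gcongr
    _ = 4 * (1 + Q) * l * e * (N ^ 2 * e) := by ring
    _ ≤ 4 * (1 + Q) * l * e * 1 := by gcongr
    _ = _ := by ring

lemma ev_exp {D a : ℝ} (hD : 0 < D) (ha : 0 < a) :
    ∀ᶠ x : ℝ in atTop, x ^ 2 * Real.exp (-a * x ^ (1 / (1 + 4 * D))) ≤ 1 := by
  have he : 0 < 1 / (1 + 4 * D) := by positivity
  have h := (tendsto_rpow_mul_exp_neg_mul_atTop_nhds_zero (2 * (1 + 4 * D)) a ha).comp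
    (tendsto_rpow_atTop he)
  filter_upwards [h.eventually (ge_mem_nhds (show (0:ℝ) < 1 by norm_num)),
    eventually_ge_atTop 0] with x hx hx0
  refine le_trans (le_of_eq ?_) hx
  simp only [Function.comp]
  rw [← Real.rpow_mul hx0]
  have : 1 / (1 + 4 * D) * (2 * (1 + 4 * D)) = (2 : ℕ) := by
    field_simp; norm_num
  rw [this, Real.rpow_natCast]

end helpers5

/-- exponential bound on the expected hyper-posterior mass of `[D, D'(n_j)]`
for the counterexample signal (with `K` chosen sufficiently small). -/
theorem stmt_18 (D : ℝ) (hD : 0 < D) (lam : Measure ℝ) [IsProbabilityMeasure lam]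
    (hsupp : lam (Set.Icc D (2 * D)) = 1) (Dstar : ℝ) (hDstar : Dstar ∈ Set.Ioo D (2 * D))
    (c : ℝ) (hc : 0 < c) (hmass : ENNReal.ofReal c < lam (Set.Icc Dstar (2 * D)))
    (β : ℝ) (hβ : β ∈ Set.Ioo D Dstar) (nseq : ℕ → ℕ) (hseq : goodSeq D nseq)
    (P : ℕ → (ℕ → ℝ) → Measure (ℕ → ℝ)) (hP : ∀ n θ0, IsObsLaw n θ0 (P n θ0))
    (D' : ℕ → ℝ) (hD'mem : ∀ j, D' j ∈ Set.Icc D (2 * D - 1 / Real.log (nseq j)))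
    (hD'mass : ∀ j, ENNReal.ofReal (c / (2 * Real.log (nseq j)))
      < lam (Set.Icc (D' j + 1 / (2 * Real.log (nseq j))) (D' j + 1 / Real.log (nseq j)))) :
    ∃ K0 : ℝ, 0 < K0 ∧ ∀ K : ℝ, 0 < K → K ≤ K0 →
      ∃ C : ℝ, 0 < C ∧ ∃ c1 : ℝ, 0 < c1 ∧ ∀ᶠ j in Filter.atTop,
        (∫ X, hyperProbOn lam D (nseq j) X (Set.Icc D (D' j))
            ∂(P (nseq j) (counterSignal β K nseq)))
          ≤ C * Real.exp (-c1 * (nseq j : ℝ) ^ (1 / (1 + 4 * D))) * Real.log (nseq j) := by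
  obtain ⟨cF, hcF, hF⟩ := F_lower hD
  obtain ⟨CG, hCG, hG⟩ := G_upper hD
  refine ⟨cF / (8 * CG), by positivity, fun K hK hK0 => ?_⟩
  obtain ⟨S, hS⟩ : ∃ S, S = ∑' i, (idx i) ^ (-(1 + 2 * D)) * Real.log (idx i) := ⟨_, rfl⟩
  have hQ0 : 0 < Real.exp (2 * (D * S)) * 2 / c := by positivity
  refine ⟨4 * (1 + Real.exp (2 * (D * S)) * 2 / c), by positivity, cF / 128, by positivity, ?_⟩
  obtain ⟨hs0, hsm, hsr⟩ := hseq
  have hge2 : ∀ j, 2 ≤ nseq j := fun j => hs0.trans (hsm.monotone (Nat.zero_le j))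
  have htop : Tendsto (fun j => (nseq j : ℝ)) atTop atTop :=
    tendsto_natCast_atTop_atTop.comp hsm.tendsto_atTop
  have he : 0 < 1 / (1 + 4 * D) := by positivity
  rw [← map_add_atTop_eq_nat 1, eventually_map]
  have hsh : Tendsto (fun j : ℕ => j + 1) atTop atTop := tendsto_add_atTop_nat 1
  have htop1 := htop.comp hsh
  filter_upwards [hsr.eventually_ge_atTop 1, (hsr.comp hsh).eventually_ge_atTop 1,
    htop1.eventually (ev_exp hD (show 0 < cF / 128 by positivity)),
    ((tendsto_rpow_atTop he).comp htop1).eventually_ge_atTop 4,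
    (Real.tendsto_log_atTop.comp htop1).eventually_ge_atTop 1,
    (Real.tendsto_log_atTop.comp htop1).eventually_ge_atTop (1 / (2 * D))]
    with j hr1 hr2 hex h4 hl1 hlD
  simp only [Function.comp] at hr2 hex h4 hl1 hlD
  have hpow : ∀ i, 0 < (nseq i : ℝ) ^ (1 + 4 * D) := fun i =>
    Real.rpow_pos_of_pos (by have := hge2 i; positivity) _
  rw [one_le_div (hpow _)] at hr1 hr2
  have hn1 : 1 ≤ nseq (j + 1) := le_trans (by norm_num) (hge2 (j + 1))
  have hG' := hG β K nseq j hβ.1 (hβ.2.trans hDstar.2) hK hsm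
    (le_trans (by norm_num) (hge2 j)) hr1 hr2 hl1
  have hF' := hF (nseq (j + 1)) hn1 h4
  have hmem := hD'mem (j + 1)
  have hms := hD'mass (j + 1)
  generalize hd : D' (j + 1) = d at hmem hms ⊢
  generalize nseq (j + 1) = n at hG' hF' hmem hms hex h4 hl1 hlD hn1 ⊢
  have hnR : (1 : ℝ) ≤ n := by exact_mod_cast hn1
  have hlpos : 0 < Real.log n := by linarith
  obtain ⟨hm1, hm2⟩ := hmem
  have hhalf : 1 / (2 * Real.log n) ≤ D := by
    rw [div_le_iff₀ (by positivity)] at hlD ⊢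
    nlinarith
  have hsum : 1 / Real.log n = 1 / (2 * Real.log n) + 1 / (2 * Real.log n) := by
    field_simp; norm_num
  have hhpos : 0 < 1 / (2 * Real.log n) := by positivity
  have hsp : 0 < D / n := by positivity
  obtain ⟨k, hk⟩ := pigeon lam (s := D / n) hsp n (show 0 ≤ c / (2 * Real.log n) by positivity)
    (by have : (n : ℝ) * (D / n) = D := by field_simp
        rw [this]; linarith) hms
  have hks : 0 ≤ (k : ℝ) * (D / n) := by positivity
  have hks1 : ((k : ℝ) + 1) * (D / n) = k * (D / n) + D / n := by ring
  set w := min (d + 1 / (2 * Real.log n) + ((k : ℝ) + 1) * (D / n)) (d + 1 / Real.log n) with hw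
  have hwl : d + 1 / (2 * Real.log n) ≤ w := le_min (by linarith) (by linarith)
  have hwu : w ≤ 2 * D := (min_le_right _ _).trans (by linarith)
  have hwv : w ≤ d + 1 / (2 * Real.log n) + (k : ℝ) * (D / n) + D / n :=
    (min_le_left _ _).trans (by linarith)
  have hgood : ∀ᵐ X ∂(P n (counterSignal β K nseq)), GoodX D X :=
    ae_summable n _ _ (hP n _) (fun i => (idx i) ^ (-(1 + 2 * D)))
      (fun i => (Real.rpow_pos_of_pos (idx_pos i) _).le) (summable_idx (by linarith)) K
      (counter_sq_le hD hβ.1 hK nseq)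
  have hmain := main_bound hD lam (n := n) (by omega) (counterSignal β K nseq) _ (hP n _) hgood
    (D' := d) (w := w) hm1 (by linarith) hS (v := d + 1 / (2 * Real.log n) + (k : ℝ) * (D / n))
    (by linarith) hwu hwv (by linarith)
    (mV := c / (2 * Real.log n) / (n + 1)) (by positivity) hk
    (cF * (n : ℝ) ^ (1 / (1 + 4 * D))) ?_
  · exact hmain.trans (final_numeric rfl (Real.exp_pos _) hc hnR hl1 hex)
  · intro α hα hαd
    filter_upwards [eventually_ge_atTop (2 * n)] with J hJ
    have hL : ∀ x ∈ Set.Icc D (2 * D), 2 * cF * (n : ℝ) ^ (1 / (1 + 4 * D)) * Real.log n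
        ≤ 4 * FJ n J x - 16 * GJ n (counterSignal β K nseq) J x := by
      intro x hx
      have h1 := hF' x hx J hJ
      have h2 := hG' x hx J
      have hxp : 0 < 1 + 2 * x := by linarith [hx.1]
      have h3 : (n : ℝ) ^ (1 / (1 + 4 * D)) ≤ (n : ℝ) ^ (1 / (1 + 2 * x)) :=
        Real.rpow_le_rpow_of_exponent_le hnR
          (one_div_le_one_div_of_le hxp (by linarith [hx.2]))
      have h4' : CG * K ≤ cF / 8 := by
        rw [le_div_iff₀ (by positivity)] at hK0
        linarith
      have h5 : CG * K * (n : ℝ) ^ (1 / (1 + 2 * x)) * Real.log n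
          ≤ cF / 8 * (n : ℝ) ^ (1 / (1 + 2 * x)) * Real.log n := by gcongr
      have h6 : 2 * cF * (n : ℝ) ^ (1 / (1 + 4 * D)) * Real.log n
          ≤ 2 * cF * (n : ℝ) ^ (1 / (1 + 2 * x)) * Real.log n := by gcongr
      linarith
    have hgap := HJ_gap (by omega) (counterSignal β K nseq) J hL hα (by linarith : α ≤ w) hwu
    refine le_trans ?_ hgap
    have hge : 1 / (2 * Real.log n) ≤ w - α := by linarith
    calc cF * (n : ℝ) ^ (1 / (1 + 4 * D))
        = 2 * cF * (n : ℝ) ^ (1 / (1 + 4 * D)) * Real.log n * (1 / (2 * Real.log n)) := by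
          field_simp
      _ ≤ _ := by gcongr
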